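/- Let (G,S,T) be an open graph admitting a focused gFlow, let u be a vertex with u ∉ S ∪ T and let v ∈ T∖S be a vertex adjacent to u. Then the open graph ((G∧uv) − u, S, T), obtained by pivoting G along the edge uv and then deleting u, admits a focused gFlow. -/

import Mathlib

/-- The odd neighbourhood of a set `A`: vertices having an odd number of neighbours in `A`. -/
def oddNbhd {V : Type*} (G : SimpleGraph V) (A : Set V) : Set V :=
  {v | Odd ((G.neighborSet v) ∩ A).ncard}

/-- A focused gFlow on the open graph `(G, S, T)`. -/
def HasFocusedGFlow {V : Type*} (G : SimpleGraph V) (S T : Set V) : Prop :=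
  ∃ (g : V → Set V) (r : V → V → Prop),
    IsStrictOrder V r ∧
    ∀ u, u ∉ T →
      g u ⊆ Sᶜ ∧ oddNbhd G (g u) ∩ Tᶜ = {u} ∧ ∀ v ∈ g u, r u v

/-- Local complementation of `G` at `u`: adjacency between distinct neighbours of `u`
is toggled, all other adjacencies are unchanged. -/
def localComp {V : Type*} (G : SimpleGraph V) (u : V) : SimpleGraph V :=
  SimpleGraph.fromRel (fun x y =>
    (G.Adj u x ∧ G.Adj u y ∧ ¬ G.Adj x y) ∨ (¬(G.Adj u x ∧ G.Adj u y) ∧ G.Adj x y))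

/-- The pivot of `G` along the edge `uv`: `G ∧ uv = ((G ⋆ u) ⋆ v) ⋆ u`. -/
def pivot {V : Type*} (G : SimpleGraph V) (u v : V) : SimpleGraph V :=
  localComp (localComp (localComp G u) v) u

theorem localComp_adj {V : Type*} (G : SimpleGraph V) (u x y : V) :
    (localComp G u).Adj x y ↔ x ≠ y ∧ ¬ (G.Adj x y ↔ G.Adj u x ∧ G.Adj u y) := by
  simp only [localComp, SimpleGraph.fromRel_adj, G.adj_comm y x]
  tauto

theorem pivot_adj_of_ne {V : Type*} {G : SimpleGraph V} {u v x y : V} (huv : G.Adj u v)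
    (hxu : x ≠ u) (hxv : x ≠ v) (hyu : y ≠ u) (hyv : y ≠ v) (hxy : x ≠ y) :
    (pivot G u v).Adj x y ↔
      Xor (G.Adj x y) (Xor (G.Adj u x ∧ G.Adj v y) (G.Adj v x ∧ G.Adj u y)) := by
  have huv' := huv.symm
  simp only [pivot, localComp_adj, ne_eq, hxy, hxu.symm, hxv.symm, hyu.symm, hyv.symm,
    huv, huv', huv.ne', G.irrefl, Xor, not_false_iff]
  grind

theorem pivot_adj_right {V : Type*} {G : SimpleGraph V} {u v x : V} (huv : G.Adj u v)
    (hxu : x ≠ u) (hxv : x ≠ v) : (pivot G u v).Adj x v ↔ G.Adj u x := by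
  have huv' := huv.symm
  have hx := G.adj_comm x
  simp only [pivot, localComp_adj, ne_eq, hxu.symm, hxv, hxv.symm, hx,
    huv, huv', huv.ne, huv.ne', G.irrefl, not_true, not_false_iff]
  grind

open Classical in
/-- The indicator of a proposition, with values in the field with two elements. -/
noncomputable def parityInd (p : Prop) : ZMod 2 := if p then 1 else 0

theorem parityInd_of_true {p : Prop} (h : p) : parityInd p = 1 := if_pos h

theorem parityInd_of_false {p : Prop} (h : ¬ p) : parityInd p = 0 := if_neg h

theorem parityInd_and (p q : Prop) : parityInd (p ∧ q) = parityInd p * parityInd q := by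
  by_cases hp : p <;> by_cases hq : q <;> simp [parityInd, hp, hq]

theorem parityInd_xor (p q : Prop) : parityInd (Xor p q) = parityInd p + parityInd q := by
  by_cases hp : p <;> by_cases hq : q <;>
    simp [parityInd, hp, hq, Xor, CharTwo.add_self_eq_zero]

theorem parityInd_inj {p q : Prop} : parityInd p = parityInd q ↔ (p ↔ q) := by
  by_cases hp : p <;> by_cases hq : q <;> simp [parityInd, hp, hq]

theorem parityInd_mem_oddNbhd {V : Type*} [Fintype V] (G : SimpleGraph V) (A : Set V) (y : V) :
    parityInd (y ∈ oddNbhd G A) = ∑ x, parityInd (G.Adj y x) * parityInd (x ∈ A) := by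
  classical
  have hsum : ∑ x, parityInd (G.Adj y x) * parityInd (x ∈ A)
      = (((G.neighborSet y) ∩ A).ncard : ZMod 2) := by
    have hterm : ∀ x, parityInd (G.Adj y x) * parityInd (x ∈ A)
        = if x ∈ G.neighborSet y ∩ A then 1 else 0 := fun x => by
      rw [← parityInd_and]
      split_ifs with h
      exacts [parityInd_of_true h, parityInd_of_false h]
    simp only [hterm]
    rw [Finset.sum_boole, Set.ncard_eq_toFinset_card']
    congr 2
    ext x
    simp
  rw [hsum]
  by_cases h : Odd ((G.neighborSet y) ∩ A).ncard
  · rw [parityInd_of_true (p := y ∈ oddNbhd G A) h, ZMod.natCast_eq_one_iff_odd.2 h]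
  · rw [parityInd_of_false (p := y ∈ oddNbhd G A) h,
      ZMod.natCast_eq_zero_iff_even.2 (Nat.not_odd_iff_even.1 h)]

/-- Exchanging the coordinates at `v` of a set and of its odd neighbourhood. -/
theorem mem_oddNbhd_pivot {V : Type*} [Finite V] {G : SimpleGraph V} {u v : V}
    (huv : G.Adj u v) {A : Set V} (hA : u ∉ oddNbhd G A) {y : V} (hyu : y ≠ u) (hyv : y ≠ v) :
    y ∈ oddNbhd (pivot G u v)
        {x | (x ≠ u ∧ x ≠ v ∧ x ∈ A) ∨ (x = v ∧ v ∈ oddNbhd G A)} ↔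
      y ∈ oddNbhd G A := by
  classical
  have := Fintype.ofFinite V
  have hu0 := parityInd_of_false hA
  rw [← parityInd_inj]
  set c := parityInd (v ∈ oddNbhd G A) with hc
  have key : ∀ x, parityInd ((pivot G u v).Adj y x) * parityInd
        (x ∈ {x | (x ≠ u ∧ x ≠ v ∧ x ∈ A) ∨ (x = v ∧ v ∈ oddNbhd G A)}) =
      parityInd (G.Adj y x) * parityInd (x ∈ A)
        + parityInd (G.Adj u y) * (parityInd (G.Adj v x) * parityInd (x ∈ A))
        + parityInd (G.Adj v y) * (parityInd (G.Adj u x) * parityInd (x ∈ A))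
        + if x = v then parityInd (G.Adj u y) * c else 0 := by
    intro x
    by_cases hxu : x = u
    · subst hxu
      simp [huv.ne, parityInd_of_true huv.symm, G.adj_comm y x, parityInd_of_false,
        CharTwo.add_self_eq_zero]
    by_cases hxv : x = v
    · subst hxv
      simp [hxu, parityInd_of_true huv, G.adj_comm y x, parityInd_of_false, c,
        pivot_adj_right huv hyu hyv, CharTwo.add_self_eq_zero]
    have hmem : (x ∈ {x | (x ≠ u ∧ x ≠ v ∧ x ∈ A) ∨ (x = v ∧ v ∈ oddNbhd G A)}) = (x ∈ A) := by
      simp [hxu, hxv]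
    rw [hmem, if_neg hxv]
    by_cases hxy : y = x
    · subst hxy
      simp only [SimpleGraph.irrefl, parityInd_of_false not_false]
      linear_combination (-1 : ZMod 2) * CharTwo.add_self_eq_zero
        (parityInd (G.Adj u y) * (parityInd (G.Adj v y) * parityInd (y ∈ A)))
    · rw [pivot_adj_of_ne huv hyu hyv hxu hxv hxy, parityInd_xor, parityInd_xor, parityInd_and,
        parityInd_and]
      ring
  rw [parityInd_mem_oddNbhd, Finset.sum_congr rfl fun x _ => key x]
  simp only [Finset.sum_add_distrib, ← Finset.mul_sum, ← parityInd_mem_oddNbhd, hu0,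
    Finset.sum_ite_eq', Finset.mem_univ, if_true, ← hc]
  linear_combination CharTwo.add_self_eq_zero (parityInd (G.Adj u y) * c)

theorem mem_oddNbhd_induce {V : Type*} (G : SimpleGraph V) {W A : Set V} (hA : A ⊆ W) (y : W) :
    y ∈ oddNbhd (G.induce W) (Subtype.val ⁻¹' A) ↔ (y : V) ∈ oddNbhd G A := by
  have h : (Subtype.val '' ((G.induce W).neighborSet y ∩ Subtype.val ⁻¹' A) : Set V)
      = G.neighborSet y ∩ A := by
    ext x
    simp only [Set.mem_image, Set.mem_inter_iff, SimpleGraph.mem_neighborSet, Set.mem_preimage,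
      SimpleGraph.comap_adj, Subtype.exists]
    constructor
    · rintro ⟨a, ha, h, rfl⟩
      exact h
    · exact fun h => ⟨x, hA h.2, h, rfl⟩
  simp only [oddNbhd, Set.mem_ofPred_eq, ← h, Set.ncard_image_of_injective _ Subtype.val_injective]

/-- Pivoting along an edge `uv` where `u ∉ S ∪ T` is internal and `v ∈ T ∖ S` is a sink,
and then deleting `u`, preserves admittance of a focused gFlow. -/
theorem pivot_deleteOne_hasFocusedGFlow {V : Type*} [Finite V]
    (G : SimpleGraph V) (S T : Set V) (u v : V)
    (hu : u ∉ S ∪ T) (hvT : v ∈ T) (hvS : v ∉ S) (huv : G.Adj u v)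
    (h : HasFocusedGFlow G S T) :
    HasFocusedGFlow ((pivot G u v).induce {x | x ≠ u})
      (Subtype.val ⁻¹' S) (Subtype.val ⁻¹' T) := by
  obtain ⟨g, r, hr, hg⟩ := h
  let f : V → Set V := fun w =>
    {x | (x ≠ u ∧ x ≠ v ∧ x ∈ g w) ∨ (x = v ∧ v ∈ oddNbhd G (g w))}
  have hf : ∀ w, f w ⊆ {x | x ≠ u} := by
    rintro w x (h | ⟨rfl, -⟩)
    · exact h.1
    · exact huv.ne'
  refine ⟨fun w => Subtype.val ⁻¹' f w,
    fun x y => (x : V) ≠ v ∧ ((y : V) = v ∨ r x y), ?_, ?_⟩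
  · exact
      { irrefl := fun x h => h.2.elim h.1 (hr.irrefl _)
        trans := fun x y z hxy hyz => ⟨hxy.1, hyz.2.imp_right fun h =>
          hr.trans _ _ _ (hxy.2.resolve_left hyz.1) h⟩ }
  rintro ⟨w, hwu⟩ (hwT : w ∉ T)
  obtain ⟨hS, hodd, hlt⟩ := hg w hwT
  have hwv : w ≠ v := fun h => hwT (h ▸ hvT)
  have hodd' : ∀ y, y ∉ T → (y ∈ oddNbhd G (g w) ↔ y = w) := fun y hy => by
    simpa [hy] using Set.ext_iff.1 hodd y
  have huw : u ∉ oddNbhd G (g w) := fun h =>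
    hwu ((hodd' u fun hT => hu (Or.inr hT)).1 h).symm
  refine ⟨?_, ?_, ?_⟩
  · rintro ⟨x, hxu⟩ (⟨-, -, hx⟩ | ⟨hx : x = v, -⟩)
    · exact hS hx
    · exact fun h : x ∈ S => hvS (hx ▸ h)
  · ext ⟨y, hyu⟩
    simp only [Set.mem_inter_iff, Set.mem_compl_iff, Set.mem_preimage, Set.mem_singleton_iff,
      Subtype.mk.injEq, mem_oddNbhd_induce _ (hf w)]
    by_cases hyT : y ∈ T
    · exact ⟨fun h => absurd hyT h.2, fun h => absurd (h ▸ hyT) hwT⟩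
    · have hyv : y ≠ v := fun h => hyT (h ▸ hvT)
      rw [mem_oddNbhd_pivot huv huw hyu hyv, hodd' y hyT]
      exact and_iff_left hyT
  · rintro ⟨x, hxu⟩ (⟨-, -, hx⟩ | ⟨hx, -⟩)
    · exact ⟨hwv, Or.inr (hlt x hx)⟩
    · exact ⟨hwv, Or.inl hx⟩
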